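/- (Dubinskiĭ's theorem for seminormed sets, case (b).) Let T > 0, let A₀ and A₁ be real Banach spaces with A₀ continuously embedded in A₁, and let M be a seminormed set in A₀ that is compactly embedded in A₀. Let 1 ≤ p < ∞ and p₁ = 1. Then Y is compactly embedded in L^p(0,T; A₀): every sequence (u_n) in Y with sup_n [u_n]_Y < ∞ has a subsequence that converges in the norm of L^p(0,T; A₀). -/

import Mathlib

open Filter Topology MeasureTheory
open scoped ENNReal

lemma tb_aux {A₀ : Type*} [NormedAddCommGroup A₀] (B : Set A₀)
    (h : ∀ a : ℕ → A₀, (∀ n, a n ∈ B) → ∃ (ψ : ℕ → ℕ) (l : A₀), StrictMono ψ ∧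
        Tendsto (fun n => a (ψ n)) atTop (𝓝 l)) (δ : ℝ) (hδ : 0 < δ) :
    ∃ t : Set A₀, t.Finite ∧ ∀ x ∈ B, ∃ y ∈ t, dist x y < δ := by
  by_contra hcon
  push Not at hcon
  obtain ⟨a, ha⟩ := Set.seq_of_forall_finite_exists
    (P := fun (c : A₀) (t : Set A₀) => c ∈ B ∧ ∀ y ∈ t, δ ≤ dist c y) (fun t ht => hcon t ht)
  obtain ⟨ψ, l, hψ, hl⟩ := h a (fun n => (ha n).1)
  have hc := hl.cauchySeq
  rw [Metric.cauchySeq_iff'] at hc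
  obtain ⟨N, hN⟩ := hc δ hδ
  have h1 := hN (N+1) (by omega)
  have h2 := (ha (ψ (N+1))).2 (a (ψ N)) ⟨ψ N, hψ (Nat.lt_succ_self N), rfl⟩
  linarith

lemma ehrling_aux {A₀ A₁ : Type*} [NormedAddCommGroup A₀] [NormedSpace ℝ A₀]
    [NormedAddCommGroup A₁] [NormedSpace ℝ A₁]
    (ι : A₀ →ₗ[ℝ] A₁) (hι : Function.Injective ι)
    (C : ℝ) (hιC : ∀ a : A₀, ‖ι a‖ ≤ C * ‖a‖)
    (S : Set A₀) (ν : A₀ → ℝ)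
    (hcone : ∀ φ ∈ S, ∀ c : ℝ, c • φ ∈ S)
    (hν0 : ∀ φ ∈ S, 0 ≤ ν φ)
    (hνhom : ∀ φ ∈ S, ∀ c : ℝ, ν (c • φ) = |c| * ν φ)
    (hemb : ∃ K₀ > (0 : ℝ), ∀ φ ∈ S, ‖φ‖ ≤ K₀ * ν φ)
    (hcpt : ∀ a : ℕ → A₀, (∀ n, a n ∈ S) → (∃ K : ℝ, ∀ n, ν (a n) ≤ K) →
      ∃ (ψ : ℕ → ℕ) (l : A₀), StrictMono ψ ∧
        Tendsto (fun n => a (ψ n)) atTop (𝓝 l)) (η : ℝ) (hη : 0 < η) :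
    ∃ D : ℝ, 0 ≤ D ∧ ∀ φ ∈ S, ∀ χ ∈ S, ‖φ - χ‖ ≤ η * (ν φ + ν χ) + D * ‖ι φ - ι χ‖ := by
  by_contra hcon
  push Not at hcon
  obtain ⟨K₀, hK₀, hemb⟩ := hemb
  -- normalised sequences
  have key : ∀ n : ℕ, ∃ φ ∈ S, ∃ χ ∈ S, ν φ ≤ 1 ∧ ν χ ≤ 1 ∧ η + n * ‖ι φ - ι χ‖ ≤ ‖φ - χ‖ := by
    intro n
    obtain ⟨φ, hφ, χ, hχ, h⟩ := hcon n (Nat.cast_nonneg n)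
    have h1 := hν0 φ hφ
    have h2 := hν0 χ hχ
    have hr : 0 < ν φ + ν χ := by
      rcases (add_nonneg h1 h2).lt_or_eq with h3 | h3
      · exact h3
      · exfalso
        have e1 : ν φ = 0 := by linarith
        have e2 : ν χ = 0 := by linarith
        have b1 := hemb φ hφ
        have b2 := hemb χ hχ
        rw [e1, mul_zero] at b1
        rw [e2, mul_zero] at b2
        have c1 : φ = 0 := norm_le_zero_iff.1 b1
        have c2 : χ = 0 := norm_le_zero_iff.1 b2
        subst c1; subst c2
        simp [e1] at h
    set r := ν φ + ν χ with hrdef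
    have habs : |r⁻¹| = r⁻¹ := abs_of_pos (inv_pos.2 hr)
    refine ⟨r⁻¹ • φ, hcone _ hφ _, r⁻¹ • χ, hcone _ hχ _, ?_, ?_, ?_⟩
    · rw [hνhom _ hφ, habs, inv_mul_le_iff₀ hr]; linarith
    · rw [hνhom _ hχ, habs, inv_mul_le_iff₀ hr]; linarith
    · rw [map_smul, map_smul, ← smul_sub, ← smul_sub, norm_smul, norm_smul, Real.norm_eq_abs, habs]
      rw [le_inv_mul_iff₀ hr]
      have : r * (η + n * (r⁻¹ * ‖ι φ - ι χ‖)) = η * r + n * ‖ι φ - ι χ‖ := by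
        field_simp
      rw [this]; exact h.le
  choose a haS b hbS ha1 hb1 hab using key
  obtain ⟨ψ, l, hψ, hl⟩ := hcpt a haS ⟨1, ha1⟩
  obtain ⟨θ, m, hθ, hm⟩ := hcpt (fun n => b (ψ n)) (fun n => hbS _) ⟨1, fun n => hb1 _⟩
  have hl' := hl.comp hθ.tendsto_atTop
  have hd : Tendsto (fun n => a (ψ (θ n)) - b (ψ (θ n))) atTop (𝓝 (l - m)) := hl'.sub hm
  have hbig : η ≤ ‖l - m‖ := by
    refine ge_of_tendsto' hd.norm (fun n => ?_)
    refine le_trans ?_ (hab _)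
    have : (0:ℝ) ≤ (ψ (θ n) : ℝ) * ‖ι (a (ψ (θ n))) - ι (b (ψ (θ n)))‖ := by positivity
    linarith
  let L : A₀ →L[ℝ] A₁ := ι.mkContinuous C hιC
  have hLd : Tendsto (fun n => ‖ι (a (ψ (θ n))) - ι (b (ψ (θ n)))‖) atTop (𝓝 ‖ι (l - m)‖) := by
    have := ((L.continuous.tendsto _).comp hd).norm
    refine this.congr (fun n => ?_)
    simp [L]
  have hz : Tendsto (fun n => ‖ι (a (ψ (θ n))) - ι (b (ψ (θ n)))‖) atTop (𝓝 0) := by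
    have hinv : Tendsto (fun n : ℕ => (2 * K₀) / (ψ (θ n) : ℝ)) atTop (𝓝 0) :=
      tendsto_const_nhds.div_atTop
        (tendsto_natCast_atTop_atTop.comp ((hψ.comp hθ).tendsto_atTop))
    refine squeeze_zero' (Eventually.of_forall fun n => norm_nonneg _) ?_ hinv
    filter_upwards [((hψ.comp hθ).tendsto_atTop).eventually_gt_atTop 0] with n hn
    have hn' : (0:ℝ) < (ψ (θ n) : ℝ) := by exact_mod_cast hn
    rw [le_div_iff₀ hn']
    have h1 := hab (ψ (θ n))
    have h2 := norm_sub_le (a (ψ (θ n))) (b (ψ (θ n)))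
    have h3 := hemb _ (haS (ψ (θ n)))
    have h4 := hemb _ (hbS (ψ (θ n)))
    have h5 := ha1 (ψ (θ n))
    have h6 := hb1 (ψ (θ n))
    nlinarith
  have h0 : ‖ι (l - m)‖ = 0 := tendsto_nhds_unique hLd hz
  have : l - m = 0 := hι (by rw [norm_eq_zero.1 h0, map_zero])
  rw [this, norm_zero] at hbig
  linarith

lemma part_aux (T : ℝ) (hT : 0 < T) (N : ℕ) (hN : 0 < N) (g : ℝ → ℝ≥0∞) :
    ∫⁻ t in Set.Ioc (0:ℝ) T, g t =
      ∑ k ∈ Finset.range N, ∫⁻ t in Set.Ioc ((k:ℝ) * (T / N)) (((k+1:ℕ):ℝ) * (T / N)), g t := by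
  have hN' : (0:ℝ) < N := by exact_mod_cast hN
  have hmono : Monotone (fun k : ℕ => (k:ℝ) * (T / N)) := by
    intro i j hij
    have : (i:ℝ) ≤ j := by exact_mod_cast hij
    dsimp only
    gcongr
  have hU := hmono.biUnion_Ico_Ioc_map_succ 0 N
  have hD := hmono.pairwise_disjoint_on_Ioc_succ
  have e : Set.Ioc (0:ℝ) T = ⋃ k ∈ Finset.range N,
      Set.Ioc ((k:ℝ) * (T / N)) (((k+1:ℕ):ℝ) * (T / N)) := by
    have e1 : (N:ℝ) * (T / N) = T := by field_simp
    simp only [Nat.cast_zero, zero_mul, e1] at hU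
    rw [← hU]
    ext x; simp
  rw [e, lintegral_biUnion_finset]
  · intro i _ j _ hij
    exact hD hij
  · intro i _
    exact measurableSet_Ioc

lemma pow_aux (T : ℝ) (hT : 0 < T) (N : ℕ) (hN : 0 < N) (f : ℝ → ℝ≥0∞) (b : ℕ → ℝ≥0∞)
    (c B : ℝ≥0∞) (P : ℝ) (hP : 1 ≤ P) (hB : ∑ k ∈ Finset.range N, b k ≤ B)
    (hf : ∀ k ∈ Finset.range N, ∀ᵐ t ∂volume.restrict
      (Set.Ioc ((k:ℝ) * (T / N)) (((k+1:ℕ):ℝ) * (T / N))), f t ≤ c + b k) :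
    ∫⁻ t in Set.Ioc (0:ℝ) T, (f t) ^ P ≤
      (c + B) ^ (P - 1) * (ENNReal.ofReal (T / N) * (N * c + B)) := by
  rw [part_aux T hT N hN]
  calc _ ≤ ∑ k ∈ Finset.range N, (c + B) ^ (P - 1) * (c + b k) * ENNReal.ofReal (T / N) := by
        refine Finset.sum_le_sum fun k hk => ?_
        have hbk : b k ≤ B := (Finset.single_le_sum (fun _ _ => zero_le) hk).trans hB
        have hv : volume (Set.Ioc ((k:ℝ) * (T / N)) (((k+1:ℕ):ℝ) * (T / N)))
            = ENNReal.ofReal (T / N) := by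
          rw [Real.volume_Ioc]; congr 1; push_cast; ring
        calc _ ≤ ∫⁻ t in Set.Ioc ((k:ℝ) * (T / N)) (((k+1:ℕ):ℝ) * (T / N)),
              (c + B) ^ (P - 1) * (c + b k) := by
              refine lintegral_mono_ae ?_
              filter_upwards [hf k hk] with t ht
              calc f t ^ P ≤ (c + b k) ^ P := by gcongr
                _ = (c + b k) ^ ((P - 1) + 1) := by congr 1; ring
                _ = (c + b k) ^ (P - 1) * (c + b k) := by
                  rw [ENNReal.rpow_add_of_nonneg _ _ (by linarith) zero_le_one, ENNReal.rpow_one]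
                _ ≤ _ := by
                  gcongr
          _ = _ := by rw [setLIntegral_const, hv]
    _ = (c + B) ^ (P - 1) * (ENNReal.ofReal (T / N) * (N * c + ∑ k ∈ Finset.range N, b k)) := by
        rw [← Finset.sum_mul, ← Finset.mul_sum, Finset.sum_add_distrib]
        simp only [Finset.sum_const, Finset.card_range, nsmul_eq_mul]
        ring
    _ ≤ _ := by gcongr

lemma osc_aux {A₁ : Type*} [NormedAddCommGroup A₁] [NormedSpace ℝ A₁]
    (T : ℝ) (w : ℝ → A₁) (hw : IntegrableOn w (Set.Ioc (0 : ℝ) T)) (v : ℝ → A₁) (v0 : A₁)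
    (a b : ℝ) (ha : 0 ≤ a) (hb : b ≤ T) (s t : ℝ) (hs : s ∈ Set.Ioc a b) (ht : t ∈ Set.Ioc a b)
    (hvs : v s = v0 + ∫ r in (0:ℝ)..s, w r) (hvt : v t = v0 + ∫ r in (0:ℝ)..t, w r) :
    ‖v t - v s‖ₑ ≤ ∫⁻ r in Set.Ioc a b, ‖w r‖ₑ := by
  have hii : ∀ r ∈ Set.Ioc a b, IntervalIntegrable w volume 0 r := by
    intro r hr
    rw [intervalIntegrable_iff_integrableOn_Ioc_of_le (ha.trans hr.1.le)]
    exact hw.mono_set (Set.Ioc_subset_Ioc_right (hr.2.trans hb))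
  have e : v t - v s = ∫ r in s..t, w r := by
    rw [hvs, hvt, add_sub_add_left_eq_sub,
      intervalIntegral.integral_interval_sub_left (hii t ht) (hii s hs)]
  have h1 : ‖v t - v s‖ₑ = ‖∫ r in Set.uIoc s t, w r‖ₑ := by
    rw [e, ← ofReal_norm, ← ofReal_norm,
      intervalIntegral.norm_intervalIntegral_eq]
  rw [h1]
  refine (enorm_integral_le_lintegral_enorm _).trans (lintegral_mono_set ?_)
  intro r hr
  rw [Set.mem_uIoc] at hr
  rcases hr with hr | hr
  · exact ⟨hs.1.trans hr.1, hr.2.trans ht.2⟩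
  · exact ⟨ht.1.trans hr.1, hr.2.trans hs.2⟩

lemma sample_aux (p : ℝ≥0∞) (hp : 1 ≤ p) (hp' : p ≠ ⊤) (κ : ℝ≥0∞) (hκ : κ ≠ ⊤)
    (h : ℝ) (hh : 0 < h) :
    ∃ R : ℝ, ∀ (T a : ℝ) (f : ℝ → ℝ) (q : ℝ → Prop),
      Set.Ioc a (a + h) ⊆ Set.Ioc 0 T →
      eLpNorm f p (volume.restrict (Set.Ioc 0 T)) ≤ κ →
      (∀ᵐ t ∂volume.restrict (Set.Ioc a (a + h)), q t) →
      ∃ s ∈ Set.Ioc a (a + h), q s ∧ f s ≤ R := by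
  have hp0 : p ≠ 0 := (zero_lt_one.trans_le hp).ne'
  set V : ℝ≥0∞ := ENNReal.ofReal h ^ (1 / p.toReal) with hV
  have hV0 : V ≠ 0 := by
    rw [hV]
    exact (ENNReal.rpow_pos (ENNReal.ofReal_pos.2 hh) ENNReal.ofReal_ne_top).ne'
  have hVt : V ≠ ⊤ := ENNReal.rpow_ne_top_of_nonneg (by positivity) ENNReal.ofReal_ne_top
  have hQ : (κ + 1) / V ≠ ⊤ := ENNReal.div_ne_top (by simp [hκ]) hV0
  refine ⟨((κ + 1) / V).toReal, fun T a f q hsub hf hq => ?_⟩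
  by_contra hcon
  push Not at hcon
  set R := ((κ + 1) / V).toReal
  have h1 : eLpNorm (fun _ : ℝ => R) p (volume.restrict (Set.Ioc a (a + h)))
      ≤ eLpNorm f p (volume.restrict (Set.Ioc a (a + h))) := by
    refine eLpNorm_mono_ae ?_
    filter_upwards [hq, ae_restrict_mem measurableSet_Ioc] with t ht htm
    have := hcon t htm ht
    rw [Real.norm_of_nonneg ENNReal.toReal_nonneg]
    exact this.le.trans (le_abs_self _)
  have h2 := eLpNorm_mono_measure (p := p) f (Measure.restrict_mono_set volume hsub)
  rw [eLpNorm_const' _ hp0 hp', Measure.restrict_apply_univ, Real.volume_Ioc, add_sub_cancel_left,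
    Real.enorm_of_nonneg ENNReal.toReal_nonneg, ENNReal.ofReal_toReal hQ, ← hV,
    ENNReal.div_mul_cancel hV0 hVt] at h1
  have h3 := (h1.trans h2).trans hf
  exact absurd h3 (not_le.2 (ENNReal.lt_add_right hκ one_ne_zero))

lemma discr_aux {A₀ : Type*} {A₁ : Type*} [NormedAddCommGroup A₀] [NormedSpace ℝ A₀]
    [NormedAddCommGroup A₁] [NormedSpace ℝ A₁]
    (ι : A₀ →ₗ[ℝ] A₁)
    (C : ℝ) (hC : 0 < C) (hιC : ∀ a : A₀, ‖ι a‖ ≤ C * ‖a‖)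
    (T : ℝ) (hT : 0 < T)
    (S : Set A₀) (ν : A₀ → ℝ)
    (hcpt : ∀ a : ℕ → A₀, (∀ n, a n ∈ S) → (∃ K : ℝ, ∀ n, ν (a n) ≤ K) →
      ∃ (ψ : ℕ → ℕ) (l : A₀), StrictMono ψ ∧
        Tendsto (fun n => a (ψ n)) atTop (𝓝 l))
    (p : ℝ≥0∞) (hp : 1 ≤ p) (hp' : p ≠ ⊤)
    (u : ℕ → ℝ → A₀) (w : ℕ → ℝ → A₁)
    (huS : ∀ n, ∀ t ∈ Set.Icc (0 : ℝ) T, u n t ∈ S)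
    (hwint : ∀ n, IntegrableOn (w n) (Set.Ioc (0 : ℝ) T))
    (hrep : ∀ n, ∀ᵐ t ∂volume.restrict (Set.Icc (0 : ℝ) T),
      ι (u n t) = ι (u n 0) + ∫ s in (0 : ℝ)..t, w n s)
    (κ : ℝ≥0∞) (hκ : κ ≠ ⊤)
    (hb1 : ∀ n, eLpNorm (fun t => ν (u n t)) p (volume.restrict (Set.Ioc (0 : ℝ) T)) ≤ κ)
    (hb2 : ∀ n, ∫⁻ t in Set.Ioc (0 : ℝ) T, ‖w n t‖ₑ ≤ κ)
    (P : ℝ) (hP : 1 ≤ P) (τ : ℝ≥0∞) (hτ : τ ≠ 0) :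
    ∃ (N : ℕ) (t : Set A₀) (_ : t.Finite) (G : ℕ → Fin N → t), ∀ n m, G n = G m →
      ∫⁻ r in Set.Ioc (0:ℝ) T, ‖ι (u n r) - ι (u m r)‖ₑ ^ P ≤ τ := by
  set D : ℝ≥0∞ := (1 + 2 * κ) ^ (P - 1) * (ENNReal.ofReal T + ENNReal.ofReal T * (2 * κ)) with hD
  have hDt : D ≠ ⊤ := by
    have h2κ : 2 * κ ≠ ⊤ := ENNReal.mul_ne_top (by simp) hκ
    refine ENNReal.mul_ne_top (ENNReal.rpow_ne_top_of_nonneg (by linarith) (by simp [h2κ])) ?_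
    exact ENNReal.add_ne_top.2 ⟨by simp, ENNReal.mul_ne_top (by simp) h2κ⟩
  obtain ⟨x₀, hx₀, hx₀D⟩ := ENNReal.exists_nnreal_pos_mul_lt hDt hτ
  set x : ℝ := min x₀ 1 with hx
  have hx0 : 0 < x := lt_min (by exact_mod_cast hx₀) one_pos
  have hx1 : x ≤ 1 := min_le_right _ _
  have hxD : ENNReal.ofReal x * D ≤ τ := by
    refine le_trans ?_ hx₀D.le
    gcongr
    rw [← ENNReal.ofReal_coe_nnreal]
    exact ENNReal.ofReal_le_ofReal (min_le_left _ _)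
  obtain ⟨N, hNx⟩ := exists_nat_gt (1 / x)
  have hN0 : (0:ℝ) < N := lt_trans (by positivity) hNx
  have hN : 0 < N := by exact_mod_cast hN0
  have hNx' : T / N ≤ T * x := by
    rw [div_le_iff₀ hN0]
    rw [div_lt_iff₀ hx0] at hNx
    nlinarith
  have hh : 0 < T / N := by positivity
  obtain ⟨R, hR⟩ := sample_aux p hp hp' κ hκ (T / N) hh
  have heq : ∀ k : ℕ, ((k+1:ℕ):ℝ) * (T / N) = (k:ℝ) * (T / N) + T / N := by
    intro k; push_cast; ring
  have hlo : ∀ k : ℕ, 0 ≤ (k:ℝ) * (T / N) := fun k => by positivity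
  have hhi : ∀ k < N, ((k+1:ℕ):ℝ) * (T / N) ≤ T := by
    intro k hk
    have h1 : ((k+1:ℕ):ℝ) ≤ N := by exact_mod_cast hk
    calc ((k+1:ℕ):ℝ) * (T / N) ≤ N * (T / N) := by gcongr
      _ = T := by field_simp
  have hsub : ∀ k < N, Set.Ioc ((k:ℝ) * (T / N)) (((k+1:ℕ):ℝ) * (T / N)) ⊆ Set.Ioc 0 T :=
    fun k hk => Set.Ioc_subset_Ioc (hlo k) (hhi k hk)
  have hrepk : ∀ n, ∀ k < N, ∀ᵐ t ∂volume.restrict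
      (Set.Ioc ((k:ℝ) * (T / N)) (((k+1:ℕ):ℝ) * (T / N))),
      ι (u n t) = ι (u n 0) + ∫ s in (0 : ℝ)..t, w n s := by
    intro n k hk
    exact ae_restrict_of_ae_restrict_of_subset ((hsub k hk).trans Set.Ioc_subset_Icc_self) (hrep n)
  have hsamp : ∀ n, ∀ k : Fin N, ∃ s ∈ Set.Ioc ((k:ℕ) * (T / N)) ((((k:ℕ)+1:ℕ):ℝ) * (T / N)),
      ι (u n s) = ι (u n 0) + (∫ s in (0 : ℝ)..s, w n s) ∧ ν (u n s) ≤ R := by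
    intro n k
    have h1 := hR T ((k:ℕ) * (T / N)) (fun t => ν (u n t))
      (fun t => ι (u n t) = ι (u n 0) + ∫ s in (0 : ℝ)..t, w n s)
    rw [← heq] at h1
    exact h1 (hsub k k.2) (hb1 n) (hrepk n k k.2)
  choose s hsI hsrep hsR using hsamp
  have hδ : 0 < x / (2 * C) := by positivity
  obtain ⟨t, htf, ht⟩ := tb_aux {φ | φ ∈ S ∧ ν φ ≤ R}
    (fun a ha => hcpt a (fun n => (ha n).1) ⟨R, fun n => (ha n).2⟩) (x / (2 * C)) hδ
  have hG : ∀ n, ∀ k : Fin N, ∃ y : t, dist (u n (s n k)) y < x / (2 * C) := by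
    intro n k
    obtain ⟨y, hy, hyd⟩ := ht (u n (s n k))
      ⟨huS n _ (Set.Ioc_subset_Icc_self (hsub k k.2 (hsI n k))), hsR n k⟩
    exact ⟨⟨y, hy⟩, hyd⟩
  choose G hGd using hG
  refine ⟨N, t, htf, G, fun n m hnm => ?_⟩
  set b : ℕ → ℝ≥0∞ := fun k =>
    (∫⁻ r in Set.Ioc ((k:ℝ) * (T / N)) (((k+1:ℕ):ℝ) * (T / N)), ‖w n r‖ₑ) +
    (∫⁻ r in Set.Ioc ((k:ℝ) * (T / N)) (((k+1:ℕ):ℝ) * (T / N)), ‖w m r‖ₑ) with hb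
  have hbB : ∑ k ∈ Finset.range N, b k ≤ 2 * κ := by
    rw [hb, Finset.sum_add_distrib, ← part_aux T hT N hN, ← part_aux T hT N hN, two_mul]
    exact add_le_add (hb2 n) (hb2 m)
  refine (pow_aux T hT N hN (fun r => ‖ι (u n r) - ι (u m r)‖ₑ) b (ENNReal.ofReal x) (2 * κ) P hP
    hbB ?_).trans ?_
  · intro k hk
    rw [Finset.mem_range] at hk
    filter_upwards [hrepk n k hk, hrepk m k hk, ae_restrict_mem measurableSet_Ioc] with r h1 h2 hr
    have o1 := osc_aux T (w n) (hwint n) (fun r => ι (u n r)) (ι (u n 0)) _ _ (hlo k) (hhi k hk)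
      (s n ⟨k, hk⟩) r (hsI n ⟨k, hk⟩) hr (hsrep n ⟨k, hk⟩) h1
    have o2 := osc_aux T (w m) (hwint m) (fun r => ι (u m r)) (ι (u m 0)) _ _ (hlo k) (hhi k hk)
      (s m ⟨k, hk⟩) r (hsI m ⟨k, hk⟩) hr (hsrep m ⟨k, hk⟩) h2
    have o3 : ‖ι (u n (s n ⟨k, hk⟩)) - ι (u m (s m ⟨k, hk⟩))‖ₑ ≤ ENNReal.ofReal x := by
      rw [← ofReal_norm]
      apply ENNReal.ofReal_le_ofReal
      rw [← map_sub]
      refine (hιC _).trans ?_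
      have d1 := hGd n ⟨k, hk⟩
      have d2 := hGd m ⟨k, hk⟩
      rw [← hnm] at d2
      have d3 := dist_triangle_right (u n (s n ⟨k, hk⟩)) (u m (s m ⟨k, hk⟩)) (G n ⟨k, hk⟩ : A₀)
      rw [← dist_eq_norm]
      calc C * dist (u n (s n ⟨k, hk⟩)) (u m (s m ⟨k, hk⟩))
          ≤ C * (x / (2 * C) + x / (2 * C)) := by gcongr; linarith
        _ = x := by field_simp; ring
    have e : ι (u n r) - ι (u m r) = (ι (u n (s n ⟨k, hk⟩)) - ι (u m (s m ⟨k, hk⟩)))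
        + ((ι (u n r) - ι (u n (s n ⟨k, hk⟩))) - (ι (u m r) - ι (u m (s m ⟨k, hk⟩)))) := by abel
    rw [e]
    refine (enorm_add_le _ _).trans (add_le_add o3 ?_)
    exact enorm_sub_le.trans (add_le_add o1 o2)
  · have hc1 : ENNReal.ofReal x ≤ 1 := by simpa using hx1
    have e1 : ENNReal.ofReal (T / N) * N = ENNReal.ofReal T := by
      rw [← ENNReal.ofReal_natCast, ← ENNReal.ofReal_mul hh.le]
      congr 1; field_simp
    calc _ ≤ (1 + 2 * κ) ^ (P - 1) *
          (ENNReal.ofReal T * ENNReal.ofReal x + ENNReal.ofReal T * ENNReal.ofReal x * (2 * κ)) := by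
          rw [mul_add, ← mul_assoc, e1, ← ENNReal.ofReal_mul hT.le]
          gcongr
      _ = ENNReal.ofReal x * D := by rw [hD]; ring
      _ ≤ τ := hxD

/-- Dubinskiĭ's theorem, case (b): A₀ ↪ A₁ Banach spaces, M a seminormed set (in the
sense of Dubinskiĭ) compactly embedded in A₀, 1 ≤ p < ∞, p₁ = 1. Then Y is compactly embedded in
L^p(0,T;A₀): every [·]_Y-bounded sequence has a subsequence converging in L^p(0,T;A₀). -/
theorem stmt11
    {A₀ A₁ : Type*} [NormedAddCommGroup A₀] [NormedSpace ℝ A₀] [CompleteSpace A₀]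
    [NormedAddCommGroup A₁] [NormedSpace ℝ A₁] [CompleteSpace A₁]
    -- A₀ is continuously embedded in A₁ via the injective linear map `ι`
    (ι : A₀ →ₗ[ℝ] A₁) (hι : Function.Injective ι)
    (C : ℝ) (hC : 0 < C) (hιC : ∀ a : A₀, ‖ι a‖ ≤ C * ‖a‖)
    (T : ℝ) (hT : 0 < T)
    -- M = S is a seminormed set in A₀ with seminorm ν
    (S : Set A₀) (ν : A₀ → ℝ)
    (hcone : ∀ φ ∈ S, ∀ c : ℝ, c • φ ∈ S)
    (hν0 : ∀ φ ∈ S, 0 ≤ ν φ)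
    (hνeq0 : ∀ φ ∈ S, (ν φ = 0 ↔ φ = 0))
    (hνhom : ∀ φ ∈ S, ∀ c : ℝ, ν (c • φ) = |c| * ν φ)
    -- M is embedded in A₀
    (hemb : ∃ K₀ > (0 : ℝ), ∀ φ ∈ S, ‖φ‖ ≤ K₀ * ν φ)
    -- the embedding of M in A₀ is compact
    (hcpt : ∀ a : ℕ → A₀, (∀ n, a n ∈ S) → (∃ K : ℝ, ∀ n, ν (a n) ≤ K) →
      ∃ (ψ : ℕ → ℕ) (l : A₀), StrictMono ψ ∧
        Tendsto (fun n => a (ψ n)) atTop (𝓝 l))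
    -- 1 ≤ p < ∞ and p₁ = 1
    (p : ℝ≥0∞) (hp : 1 ≤ p) (hp' : p ≠ ⊤)
    -- (u_n) is a sequence in Y, with derivatives (w_n) taking values in A₁
    (u : ℕ → ℝ → A₀) (w : ℕ → ℝ → A₁)
    (huS : ∀ n, ∀ t ∈ Set.Icc (0 : ℝ) T, u n t ∈ S)
    (humeas : ∀ n, AEStronglyMeasurable (u n) (volume.restrict (Set.Ioc (0 : ℝ) T)))
    (hνmeas : ∀ n, AEMeasurable (fun t => ν (u n t)) (volume.restrict (Set.Ioc (0 : ℝ) T)))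
    (hwint : ∀ n, IntegrableOn (w n) (Set.Ioc (0 : ℝ) T))
    (hrep : ∀ n, ∀ᵐ t ∂volume.restrict (Set.Icc (0 : ℝ) T),
      ι (u n t) = ι (u n 0) + ∫ s in (0 : ℝ)..t, w n s)
    -- the sequence is bounded in Y₊: sup_n [u_n]_Y < ∞
    (K : ℝ)
    (hbound : ∀ n,
      eLpNorm (fun t => ν (u n t)) p (volume.restrict (Set.Ioc (0 : ℝ) T))
        + eLpNorm (w n) 1 (volume.restrict (Set.Ioc (0 : ℝ) T)) ≤ ENNReal.ofReal K) :
    ∃ ψ : ℕ → ℕ, StrictMono ψ ∧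
      ∃ g : ℝ → A₀,
        Tendsto
          (fun j => eLpNorm (fun t => u (ψ j) t - g t) p (volume.restrict (Set.Ioc (0 : ℝ) T)))
          atTop (𝓝 0) := by
  obtain ⟨K₀, hK₀, hemb'⟩ := hemb
  have : Fact (1 ≤ p) := ⟨hp⟩
  have hp0 : p ≠ 0 := (zero_lt_one.trans_le hp).ne'
  set μ := volume.restrict (Set.Ioc (0 : ℝ) T) with hμ
  set κ := ENNReal.ofReal K with hκdef
  have hκ : κ ≠ ⊤ := ENNReal.ofReal_ne_top
  have hb1 : ∀ n, eLpNorm (fun t => ν (u n t)) p μ ≤ κ := fun n => le_self_add.trans (hbound n)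
  have hb2 : ∀ n, ∫⁻ t, ‖w n t‖ₑ ∂μ ≤ κ := by
    intro n
    rw [← eLpNorm_one_eq_lintegral_enorm]
    exact le_add_self.trans (hbound n)
  have hP : 1 ≤ p.toReal := by
    rw [← ENNReal.toReal_one]
    exact ENNReal.toReal_mono hp' hp
  have hP0 : 0 < p.toReal := by linarith
  have hSae : ∀ n, ∀ᵐ t ∂μ, u n t ∈ S := by
    intro n
    filter_upwards [ae_restrict_mem measurableSet_Ioc] with t ht
    exact huS n t (Set.Ioc_subset_Icc_self ht)
  have hmem : ∀ n, MemLp (u n) p μ := by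
    intro n
    have hν : MemLp (fun t => ν (u n t)) p μ :=
      ⟨(hνmeas n).aestronglyMeasurable, (hb1 n).trans_lt hκ.lt_top⟩
    refine hν.of_le_mul (c := K₀) (humeas n) ?_
    filter_upwards [hSae n] with t ht
    refine (hemb' _ ht).trans ?_
    gcongr
    exact le_abs_self _
  let L : A₀ →L[ℝ] A₁ := ι.mkContinuous C hιC
  have hιmeas : ∀ n, AEStronglyMeasurable (fun t => ι (u n t)) μ := fun n =>
    L.continuous.comp_aestronglyMeasurable (humeas n)
  let U : ℕ → Lp A₀ p μ := fun n => (hmem n).toLp (u n)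
  have htb : TotallyBounded (Set.range U) := by
    refine Metric.totallyBounded_of_finite_discretization fun ε hε => ?_
    have hε' : ENNReal.ofReal (ε / 4) ≠ 0 := by
      simpa using hε
    obtain ⟨η, hη, hηκ⟩ := ENNReal.exists_nnreal_pos_mul_lt
      (a := κ + κ) (by simp [hκ]) hε'
    obtain ⟨D, hD0, hD⟩ := ehrling_aux ι hι C hιC S ν hcone hν0 hνhom ⟨K₀, hK₀, hemb'⟩ hcpt
      (η : ℝ) (by exact_mod_cast hη)
    obtain ⟨σ, hσ, hσD⟩ := ENNReal.exists_nnreal_pos_mul_lt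
      (a := ENNReal.ofReal D) (by simp) hε'
    have hσP : (σ : ℝ≥0∞) ^ p.toReal ≠ 0 :=
      (ENNReal.rpow_pos (by exact_mod_cast hσ) (by simp)).ne'
    obtain ⟨N, t, htf, G, hG⟩ := discr_aux ι C hC hιC T hT S ν hcpt p hp hp' u w huS hwint hrep κ hκ
      hb1 hb2 p.toReal hP _ hσP
    have : Fintype t := htf.fintype
    have hkey : ∀ n m, G n = G m → dist (U n) (U m) < ε := by
      intro n m hnm
      have h1 := hG n m hnm
      have h2 : eLpNorm (fun r => ι (u n r) - ι (u m r)) p μ ≤ σ := by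
        rw [eLpNorm_eq_lintegral_rpow_enorm_toReal hp0 hp']
        calc _ ≤ ((σ : ℝ≥0∞) ^ p.toReal) ^ (1 / p.toReal) := by gcongr
          _ = σ := by rw [one_div, ENNReal.rpow_rpow_inv hP0.ne']
      have h3 : eLpNorm (u n - u m) p μ ≤
          η * (κ + κ) + ENNReal.ofReal D * σ := by
        calc eLpNorm (u n - u m) p μ
            ≤ eLpNorm ((fun r => (η:ℝ) • (ν (u n r) + ν (u m r)))
                + (fun r => D • ‖ι (u n r) - ι (u m r)‖)) p μ := by
              refine eLpNorm_mono_ae ?_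
              filter_upwards [hSae n, hSae m] with r hr1 hr2
              refine (hD _ hr1 _ hr2).trans ?_
              exact le_abs_self _
          _ ≤ eLpNorm (fun r => (η:ℝ) • (ν (u n r) + ν (u m r))) p μ
              + eLpNorm (fun r => D • ‖ι (u n r) - ι (u m r)‖) p μ := by
              refine eLpNorm_add_le ?_ ?_ hp
              · exact (((hνmeas n).add (hνmeas m)).const_smul (η:ℝ)).aestronglyMeasurable
              · exact ((hιmeas n).sub (hιmeas m)).norm.const_smul D
          _ ≤ _ := by
              have q1 : eLpNorm (fun r => (η:ℝ) • (ν (u n r) + ν (u m r))) p μ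
                  = ‖(η:ℝ)‖ₑ * eLpNorm (fun r => (ν (u n r) + ν (u m r))) p μ :=
                eLpNorm_const_smul (η:ℝ) (fun r => (ν (u n r) + ν (u m r))) p μ
              have q2 : eLpNorm (fun r => D • ‖ι (u n r) - ι (u m r)‖) p μ
                  = ‖D‖ₑ * eLpNorm (fun r => ‖ι (u n r) - ι (u m r)‖) p μ :=
                eLpNorm_const_smul D (fun r => ‖ι (u n r) - ι (u m r)‖) p μ
              have q3 : eLpNorm (fun r => (ν (u n r) + ν (u m r))) p μ ≤ κ + κ :=
                (eLpNorm_add_le (hνmeas n).aestronglyMeasurable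
                  (hνmeas m).aestronglyMeasurable hp).trans (add_le_add (hb1 n) (hb1 m))
              rw [q1, q2, eLpNorm_norm, Real.enorm_of_nonneg hD0,
                Real.enorm_of_nonneg (NNReal.coe_nonneg η), ENNReal.ofReal_coe_nnreal]
              gcongr
      have h4 : edist (U n) (U m) < ENNReal.ofReal ε := by
        rw [Lp.edist_toLp_toLp]
        calc _ ≤ _ := h3
          _ ≤ ENNReal.ofReal (ε / 4) + ENNReal.ofReal (ε / 4) := by
            rw [mul_comm (ENNReal.ofReal D)]
            exact add_le_add hηκ.le hσD.le
          _ = ENNReal.ofReal (ε / 4 + ε / 4) := (ENNReal.ofReal_add (by positivity) (by positivity)).symm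
          _ < ENNReal.ofReal ε := (ENNReal.ofReal_lt_ofReal_iff hε).2 (by linarith)
      rwa [edist_dist, ENNReal.ofReal_lt_ofReal_iff hε] at h4
    refine ⟨Fin N → t, inferInstance, fun y => G y.2.choose, fun y z hyz => ?_⟩
    have := hkey _ _ hyz
    rwa [y.2.choose_spec, z.2.choose_spec] at this
  have hcomp : IsCompact (closure (Set.range U)) := TotallyBounded.isCompact_of_isClosed
    htb.closure isClosed_closure
  obtain ⟨g, -, ψ, hψ, hlim⟩ := hcomp.tendsto_subseq (fun n => subset_closure (Set.mem_range_self n))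
  refine ⟨ψ, hψ, g, ?_⟩
  rw [tendsto_iff_edist_tendsto_0] at hlim
  refine hlim.congr (fun j => ?_)
  simp only [Function.comp, U]
  rw [Lp.edist_def]
  exact eLpNorm_congr_ae ((hmem (ψ j)).coeFn_toLp.sub (EventuallyEq.refl _ _))
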